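/- Let n be a positive integer, a ∈ (0,2), b > 0 with a + b < n, γ := (n+b−a)/2, and α_{a,n} := 2^{a−1} π^{−n/2} Γ((n+a)/2)/|Γ(−a/2)|. Then for every smooth ψ : ℝⁿ → ℂ compactly supported in ℝⁿ \ {0}: α_{a,n} ∫_{ℝⁿ}∫_{ℝⁿ} (|ψ(x)|²|x|^{b/2+γ} − |ψ(y)|²|y|^{b/2+γ})(|x|^{b/2−γ} − |y|^{b/2−γ}) / |x−y|^{n+a} dx dy = 2^a (Γ((n+a)/4)/Γ((n−a)/4))² ∫_{ℝⁿ} |ψ(x)|² |x|^{b−a} dx. -/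

import Mathlib

open MeasureTheory Real

/-- The constant `α_{a,n} = 2^{a-1} π^{-n/2} Γ((n+a)/2) / |Γ(-a/2)|`. -/
noncomputable def alphaConst (n : ℕ) (a : ℝ) : ℝ :=
  2 ^ (a - 1) * Real.pi ^ (-(n : ℝ) / 2) * Real.Gamma (((n : ℝ) + a) / 2) /
    |Real.Gamma (-a / 2)|

section Auxiliary

open Set Filter Topology

theorem integral_rpow_mul_exp_neg_div_Ioi {c k : ℝ} (hc : 0 < c) (hk : 0 < k) :
    ∫ r in Ioi (0 : ℝ), r ^ (-c - 1) * exp (-k / r) = k ^ (-c) * Gamma c := by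
  have h := integral_comp_rpow_Ioi (fun t : ℝ => t ^ (c - 1) * exp (-(k * t)))
    (p := -1) (by norm_num)
  rw [integral_rpow_mul_exp_neg_mul_Ioi hc hk, one_div, inv_rpow hk.le, ← rpow_neg hk.le] at h
  rw [← h]
  refine setIntegral_congr_fun measurableSet_Ioi fun r (hr : 0 < r) => ?_
  have h1 : (r ^ (-1 : ℝ)) ^ (c - 1) = r ^ (-(c - 1)) := by
    rw [← rpow_mul hr.le]; congr 1; ring
  simp only [smul_eq_mul, h1]
  rw [abs_neg, abs_one, one_mul, ← mul_assoc, ← rpow_add hr, rpow_neg_one]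
  congr 2
  · ring
  · field_simp

theorem integral_rpow_mul_one_sub_rpow {u v : ℝ} (hu : 0 < u) (hv : 0 < v) :
    ∫ x in Ioo (0 : ℝ) 1, x ^ (u - 1) * (1 - x) ^ (v - 1) =
      Gamma u * Gamma v / Gamma (u + v) := by
  change _ = ProbabilityTheory.beta u v
  rw [ProbabilityTheory.beta_eq_betaIntegralReal u v hu hv, Complex.betaIntegral,
    intervalIntegral.integral_of_le zero_le_one, ← integral_Ioc_eq_integral_Ioo,
    ← RCLike.re_to_complex, ← integral_re]
  · refine setIntegral_congr_fun measurableSet_Ioc fun x ⟨hx1, hx2⟩ => ?_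
    norm_cast
    rw [← Complex.ofReal_cpow hx1.le, ← Complex.ofReal_cpow (by linarith), RCLike.re_to_complex,
      Complex.re_mul_ofReal, Complex.ofReal_re]
  · have := Complex.betaIntegral_convergent (u := u) (v := v) (by simpa) (by simpa)
    rwa [intervalIntegrable_iff_integrableOn_Ioc_of_le zero_le_one] at this

theorem integrableOn_rpow_mul_one_sub_rpow {u v : ℝ} (hu : 0 < u) (hv : 0 < v) :
    IntegrableOn (fun x : ℝ => x ^ (u - 1) * (1 - x) ^ (v - 1)) (Ioo 0 1) := by
  refine Integrable.of_integral_ne_zero ?_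
  rw [integral_rpow_mul_one_sub_rpow hu hv]
  have := Gamma_pos_of_pos hu
  have := Gamma_pos_of_pos hv
  have := Gamma_pos_of_pos (add_pos hu hv)
  positivity

/-- The difference `r ^ (β - 1) - (r - τ)₊ ^ (β - 1)`. -/
noncomputable def powDiff (β r τ : ℝ) : ℝ :=
  r ^ (β - 1) - if τ < r then (r - τ) ^ (β - 1) else 0

theorem abs_one_sub_one_sub_rpow_le {β x : ℝ} (hβ : 0 < β) (hx : x ∈ Ioo (0 : ℝ) 1) :
    |1 - (1 - x) ^ β| ≤ max β 1 * x := by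
  obtain ⟨h0, h1⟩ := hx
  have h2 : (1 - x) ^ β ≤ 1 := rpow_le_one (by linarith) (by linarith) hβ.le
  rw [abs_of_nonneg (by linarith)]
  rcases le_total 1 β with h | h
  · have := one_add_mul_self_le_rpow_one_add (s := -x) (by linarith) h
    rw [max_eq_left h, sub_eq_add_neg]
    rw [← sub_eq_add_neg] at this
    linarith
  · have := rpow_le_rpow_of_exponent_ge (x := 1 - x) (by linarith) (by linarith) h
    rw [rpow_one] at this
    rw [max_eq_right h]
    linarith

theorem integrableOn_rpow_mul_one_sub_one_sub_rpow {a β : ℝ} (ha : a ∈ Ioo (0 : ℝ) 2)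
    (hβ : 0 < β) :
    IntegrableOn (fun x : ℝ => x ^ (-a / 2 - 1) * (1 - (1 - x) ^ β)) (Ioo 0 1) := by
  have h : IntegrableOn (fun x : ℝ => max β 1 * x ^ (-a / 2)) (Ioo 0 1) :=
    ((intervalIntegral.integrableOn_Ioo_rpow_iff one_pos).2 (by linarith [ha.2])).const_mul _
  refine h.mono' (by fun_prop) ?_
  refine (ae_restrict_iff' measurableSet_Ioo).2 (ae_of_all _ fun x hx => ?_)
  have h1 := abs_one_sub_one_sub_rpow_le hβ hx
  have hx0 := hx.1
  rw [norm_mul, Real.norm_eq_abs, Real.norm_eq_abs, abs_of_pos (rpow_pos_of_pos hx0 _)]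
  calc _ ≤ x ^ (-a / 2 - 1) * (max β 1 * x) := by gcongr
    _ = _ := by
      rw [rpow_sub_one hx0.ne']
      field_simp

theorem integral_deriv_rpow_mul {a β : ℝ} (ha : a ∈ Ioo (0 : ℝ) 2) (hβ : 0 < β) :
    ∫ x in Ioo (0 : ℝ) 1, (x ^ (-a / 2 - 1) * (1 - (1 - x) ^ β)
      - 2 / a * β * (x ^ (1 - a / 2 - 1) * (1 - x) ^ (β - 1))) = -(2 / a) := by
  obtain ⟨ha0, ha2⟩ := ha
  rw [← integral_Ioc_eq_integral_Ioo, ← intervalIntegral.integral_of_le zero_le_one]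
  have key := intervalIntegral.integral_eq_sub_of_hasDerivAt_of_tendsto (a := 0) (b := 1)
    (f := fun x : ℝ => -(2 / a) * (x ^ (-a / 2) * (1 - (1 - x) ^ β)))
    (f' := fun x : ℝ => x ^ (-a / 2 - 1) * (1 - (1 - x) ^ β)
      - 2 / a * β * (x ^ (1 - a / 2 - 1) * (1 - x) ^ (β - 1)))
    (fa := 0) (fb := -(2 / a)) zero_lt_one ?_ ?_ ?_ ?_
  · rw [key, sub_zero]
  · intro x hx
    have hx0 := hx.1
    have hx1 : 0 < 1 - x := by linarith [hx.2]
    have h1 := (hasDerivAt_id x).rpow_const (p := -a / 2) (Or.inl hx0.ne')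
    have h2 := ((hasDerivAt_id x).const_sub 1).rpow_const (p := β) (Or.inl hx1.ne')
    have h3 := (h1.mul (h2.const_sub 1)).const_mul (-(2 / a))
    refine h3.congr_deriv ?_
    simp only [id]
    have e : (1 - a / 2 - 1) = -a / 2 := by ring
    rw [e]
    field_simp
    ring
  · rw [intervalIntegrable_iff_integrableOn_Ioo_of_le zero_le_one]
    exact (integrableOn_rpow_mul_one_sub_one_sub_rpow ⟨ha0, ha2⟩ hβ).sub
      ((integrableOn_rpow_mul_one_sub_rpow (by linarith) hβ).const_mul _)
  · have hb : ∀ᶠ x : ℝ in 𝓝[>] 0, x ∈ Ioo (0 : ℝ) 1 := Ioo_mem_nhdsGT one_pos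
    refine squeeze_zero_norm' (a := fun x : ℝ => 2 / a * (max β 1 * x ^ (1 - a / 2))) ?_ ?_
    · filter_upwards [hb] with x hx
      have h1 := abs_one_sub_one_sub_rpow_le hβ hx
      have hx0 := hx.1
      rw [norm_mul, norm_mul, Real.norm_eq_abs, Real.norm_eq_abs, Real.norm_eq_abs, abs_neg,
        abs_of_pos (rpow_pos_of_pos hx0 _), abs_of_pos (by positivity)]
      refine mul_le_mul_of_nonneg_left ?_ (by positivity)
      calc _ ≤ x ^ (-a / 2) * (max β 1 * x) := by gcongr
        _ = _ := by
          rw [show (1 - a / 2) = -a / 2 + 1 by ring, rpow_add_one hx0.ne']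
          ring
    · have : ContinuousAt (fun x : ℝ => 2 / a * (max β 1 * x ^ (1 - a / 2))) 0 := by
        have := continuousAt_rpow_const 0 (1 - a / 2) (Or.inr (by linarith : 0 < 1 - a / 2).le)
        fun_prop
      have h := this.tendsto
      rw [zero_rpow (by linarith)] at h
      simp only [mul_zero] at h
      exact h.mono_left nhdsWithin_le_nhds
  · have h : ContinuousAt (fun x : ℝ => -(2 / a) * (x ^ (-a / 2) * (1 - (1 - x) ^ β))) 1 := by
      have h1 : ContinuousAt (fun x : ℝ => x ^ (-a / 2)) 1 :=
        continuousAt_rpow_const 1 _ (Or.inl one_ne_zero)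
      have h2 : ContinuousAt (fun x : ℝ => (1 - x) ^ β) 1 :=
        (continuousAt_const.sub continuousAt_id).rpow_const (Or.inr hβ.le)
      fun_prop
    have h := h.tendsto
    rw [sub_self, zero_rpow hβ.ne', one_rpow] at h
    simp only [sub_zero, mul_one] at h
    exact h.mono_left nhdsWithin_le_nhds

theorem abs_Gamma_neg_half {a : ℝ} (ha : a ∈ Ioo (0 : ℝ) 2) :
    |Gamma (-a / 2)| = 2 / a * Gamma (1 - a / 2) := by
  obtain ⟨h0, h2⟩ := ha
  have h := Gamma_add_one (s := -a / 2) (by linarith)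
  have hp : 0 < Gamma (1 - a / 2) := Gamma_pos_of_pos (by linarith)
  rw [show -a / 2 + 1 = 1 - a / 2 by ring] at h
  have : Gamma (-a / 2) = -(2 / a * Gamma (1 - a / 2)) := by
    rw [h]; field_simp
  rw [this, abs_neg, abs_of_pos (by positivity)]

theorem integral_rpow_mul_powDiff_one {a β : ℝ} (ha : a ∈ Ioo (0 : ℝ) 2) (hβ : a / 2 < β) :
    ∫ x in Ioi (0 : ℝ), x ^ (-a / 2 - 1) * powDiff β 1 x =
      Gamma β / Gamma (β - a / 2) * |Gamma (-a / 2)| := by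
  obtain ⟨ha0, ha2⟩ := ha
  have hβ0 : 0 < β := by linarith
  have e1 : ∀ x ∈ Ioo (0 : ℝ) 1, x ^ (-a / 2 - 1) * powDiff β 1 x =
      (x ^ (-a / 2 - 1) * (1 - (1 - x) ^ β)
        - 2 / a * β * (x ^ (1 - a / 2 - 1) * (1 - x) ^ (β - 1)))
      + (2 / a * β - 1) * (x ^ (1 - a / 2 - 1) * (1 - x) ^ (β - 1)) := by
    intro x ⟨hx0, hx1⟩
    have h1 : 0 < 1 - x := by linarith
    rw [powDiff, if_pos hx1, one_rpow, show (1 - a / 2 - 1) = (-a / 2 - 1) + 1 by ring,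
      rpow_add_one hx0.ne', ← sub_add_cancel β 1, rpow_add_one h1.ne']
    simp only [add_sub_cancel_right]
    ring
  have e2 : ∀ x ∈ Ici (1 : ℝ), x ^ (-a / 2 - 1) * powDiff β 1 x = x ^ (-a / 2 - 1) := by
    intro x hx
    rw [powDiff, if_neg (not_lt.2 hx), one_rpow, sub_zero, mul_one]
  have iB := integrableOn_rpow_mul_one_sub_rpow (u := 1 - a / 2) (v := β) (by linarith) hβ0
  have iA := (integrableOn_rpow_mul_one_sub_one_sub_rpow ⟨ha0, ha2⟩ hβ0).sub
    (iB.const_mul (2 / a * β))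
  have i1 : IntegrableOn (fun x : ℝ => x ^ (-a / 2 - 1) * powDiff β 1 x) (Ioo 0 1) :=
    IntegrableOn.congr_fun (iA.add (iB.const_mul (2 / a * β - 1)))
      (fun x hx => (e1 x hx).symm) measurableSet_Ioo
  have i2 : IntegrableOn (fun x : ℝ => x ^ (-a / 2 - 1) * powDiff β 1 x) (Ici 1) :=
    IntegrableOn.congr_fun ((integrableOn_Ici_iff_integrableOn_Ioi (by simp)).2
      (integrableOn_Ioi_rpow_of_lt (by linarith) one_pos))
      (fun x hx => (e2 x hx).symm) measurableSet_Ici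
  have hd : Disjoint (Ioo (0 : ℝ) 1) (Ici 1) :=
    Set.disjoint_left.2 fun x hx hx' => not_lt.2 hx' hx.2
  rw [← Ioo_union_Ici_eq_Ioi (zero_lt_one' ℝ), setIntegral_union hd measurableSet_Ici i1 i2,
    setIntegral_congr_fun measurableSet_Ioo e1, setIntegral_congr_fun measurableSet_Ici e2,
    integral_Ici_eq_integral_Ioi, integral_Ioi_rpow_of_lt (by linarith) one_pos]
  have i3 := integral_add iA (iB.const_mul (2 / a * β - 1))
  simp only [Pi.sub_apply] at i3
  rw [i3, integral_deriv_rpow_mul ⟨ha0, ha2⟩ hβ0, integral_const_mul,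
    integral_rpow_mul_one_sub_rpow (by linarith) hβ0, abs_Gamma_neg_half ⟨ha0, ha2⟩, one_rpow,
    show 1 - a / 2 + β = β - a / 2 + 1 by ring, Gamma_add_one (by linarith)]
  have h1 : Gamma (β - a / 2) ≠ 0 := (Gamma_pos_of_pos (by linarith)).ne'
  generalize Gamma (β - a / 2) = G at h1 ⊢
  generalize Gamma β = B
  obtain ⟨c, rfl⟩ : ∃ c, β = c + a / 2 := ⟨β - a / 2, by ring⟩
  have h2 : c ≠ 0 := by linarith
  rw [show -a / 2 - 1 + 1 = -(a / 2) by ring, show c + a / 2 - a / 2 = c by ring]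
  field_simp
  ring

theorem integrableOn_rpow_mul_powDiff_one {a β : ℝ} (ha : a ∈ Ioo (0 : ℝ) 2) (hβ : a / 2 < β) :
    IntegrableOn (fun x : ℝ => x ^ (-a / 2 - 1) * powDiff β 1 x) (Ioi 0) := by
  refine Integrable.of_integral_ne_zero ?_
  rw [integral_rpow_mul_powDiff_one ha hβ, abs_Gamma_neg_half ha]
  have := Gamma_pos_of_pos (show 0 < β by linarith [ha.1])
  have := Gamma_pos_of_pos (show 0 < β - a / 2 by linarith)
  have := Gamma_pos_of_pos (show 0 < 1 - a / 2 by linarith [ha.2])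
  have := ha.1
  positivity

theorem rpow_mul_powDiff_mul {a β r x : ℝ} (hr : 0 < r) (hx : 0 < x) :
    (r * x) ^ (-a / 2 - 1) * powDiff β r (r * x) =
      r ^ (β - a / 2 - 2) * (x ^ (-a / 2 - 1) * powDiff β 1 x) := by
  have h : powDiff β r (r * x) = r ^ (β - 1) * powDiff β 1 x := by
    unfold powDiff
    have : r * x < r ↔ x < 1 := mul_lt_iff_lt_one_right hr
    simp only [this]
    split_ifs with h
    · rw [show r - r * x = r * (1 - x) by ring, mul_rpow hr.le (by linarith), one_rpow]
      ring
    · simp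
  rw [h, mul_rpow hr.le hx.le, show β - a / 2 - 2 = (-a / 2 - 1) + (β - 1) by ring, rpow_add hr]
  ring

theorem integrableOn_rpow_mul_powDiff {a β r : ℝ} (ha : a ∈ Ioo (0 : ℝ) 2) (hβ : a / 2 < β)
    (hr : 0 < r) :
    IntegrableOn (fun x : ℝ => x ^ (-a / 2 - 1) * powDiff β r x) (Ioi 0) := by
  have h := (integrableOn_Ioi_comp_mul_left_iff
    (fun x : ℝ => x ^ (-a / 2 - 1) * powDiff β r x) 0 hr).1
    (IntegrableOn.congr_fun ((integrableOn_rpow_mul_powDiff_one ha hβ).const_mul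
      (r ^ (β - a / 2 - 2))) (fun x hx => (rpow_mul_powDiff_mul hr hx).symm) measurableSet_Ioi)
  rwa [mul_zero] at h

theorem integral_rpow_mul_powDiff (a β : ℝ) {r : ℝ} (hr : 0 < r) :
    ∫ x in Ioi (0 : ℝ), x ^ (-a / 2 - 1) * powDiff β r x =
      r ^ (β - a / 2 - 1) * ∫ x in Ioi (0 : ℝ), x ^ (-a / 2 - 1) * powDiff β 1 x := by
  have h := integral_comp_mul_left_Ioi' (fun x : ℝ => x ^ (-a / 2 - 1) * powDiff β r x) 0 hr
  rw [mul_zero] at h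
  rw [← h, setIntegral_congr_fun measurableSet_Ioi fun x hx => rpow_mul_powDiff_mul hr hx,
    integral_const_mul, smul_eq_mul, ← mul_assoc, mul_comm r, ← rpow_add_one hr.ne']
  congr 2
  ring

theorem integral_abs_rpow_mul_powDiff (a β : ℝ) {r : ℝ} (hr : 0 < r) :
    ∫ x in Ioi (0 : ℝ), |x ^ (-a / 2 - 1) * powDiff β r x| =
      r ^ (β - a / 2 - 1) * ∫ x in Ioi (0 : ℝ), |x ^ (-a / 2 - 1) * powDiff β 1 x| := by
  have h := integral_comp_mul_left_Ioi' (fun x : ℝ => |x ^ (-a / 2 - 1) * powDiff β r x|) 0 hr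
  rw [mul_zero] at h
  rw [← h, setIntegral_congr_fun (g := fun x => r ^ (β - a / 2 - 2) *
      |x ^ (-a / 2 - 1) * powDiff β 1 x|) measurableSet_Ioi fun x hx => ?_,
    integral_const_mul, smul_eq_mul, ← mul_assoc, mul_comm r, ← rpow_add_one hr.ne']
  · congr 2
    ring
  · simp only
    rw [rpow_mul_powDiff_mul hr hx, abs_mul _ (_ * _), abs_of_pos (rpow_pos_of_pos hr _)]

/-- The heat kernel of `ℝⁿ` at time `t`. -/
noncomputable def heatKernel (n : ℕ) (t : ℝ) (x : EuclideanSpace ℝ (Fin n)) : ℝ :=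
  (4 * π * t) ^ (-(n : ℝ) / 2) * exp (-‖x‖ ^ 2 / (4 * t))

section HeatKernel

variable {n : ℕ}

@[fun_prop]
theorem measurable_heatKernel :
    Measurable fun p : ℝ × EuclideanSpace ℝ (Fin n) => heatKernel n p.1 p.2 := by
  unfold heatKernel
  fun_prop

theorem continuous_heatKernel (t : ℝ) : Continuous (heatKernel n t) := by
  unfold heatKernel
  fun_prop

theorem heatKernel_pos {t : ℝ} (ht : 0 < t) (x : EuclideanSpace ℝ (Fin n)) :
    0 < heatKernel n t x := by
  unfold heatKernel
  positivity

theorem heatKernel_sub_comm (t : ℝ) (x y : EuclideanSpace ℝ (Fin n)) :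
    heatKernel n t (x - y) = heatKernel n t (y - x) := by
  rw [heatKernel, norm_sub_rev, heatKernel]

theorem heatKernel_le {t : ℝ} (ht : 0 < t) (x : EuclideanSpace ℝ (Fin n)) :
    heatKernel n t x ≤ (4 * π * t) ^ (-(n : ℝ) / 2) := by
  unfold heatKernel
  refine mul_le_of_le_one_right (by positivity) (exp_le_one_iff.2 ?_)
  rw [neg_div]
  exact neg_nonpos.2 (by positivity)

/-- The constant in `∫₀^∞ t ^ (β - 1) p_t(x) dt = C |x| ^ (2 β - n)`. -/
noncomputable def heatConst (n : ℕ) (β : ℝ) : ℝ :=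
  4 ^ (-β) * π ^ (-(n : ℝ) / 2) * Gamma ((n : ℝ) / 2 - β)

theorem heatConst_pos {β : ℝ} (hβ : β < (n : ℝ) / 2) : 0 < heatConst n β := by
  have := Gamma_pos_of_pos (sub_pos.2 hβ)
  unfold heatConst
  positivity

theorem integral_rpow_mul_heatKernel {β : ℝ} (hβ : β < (n : ℝ) / 2)
    {x : EuclideanSpace ℝ (Fin n)} (hx : x ≠ 0) :
    ∫ t in Ioi (0 : ℝ), t ^ (β - 1) * heatKernel n t x =
      heatConst n β * ‖x‖ ^ (2 * β - n) := by
  have hx' : 0 < ‖x‖ := norm_pos_iff.2 hx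
  have h := integral_rpow_mul_exp_neg_div_Ioi (sub_pos.2 hβ) (k := ‖x‖ ^ 2 / 4) (by positivity)
  have e : ∀ t ∈ Ioi (0 : ℝ), t ^ (β - 1) * heatKernel n t x = (4 * π) ^ (-(n : ℝ) / 2) *
      (t ^ (-((n : ℝ) / 2 - β) - 1) * exp (-(‖x‖ ^ 2 / 4) / t)) := by
    intro t (ht : 0 < t)
    rw [heatKernel, mul_rpow (by positivity) ht.le,
      show -((n : ℝ) / 2 - β) - 1 = (β - 1) + -(n : ℝ) / 2 by ring, rpow_add ht,
      show -(‖x‖ ^ 2 / 4) / t = -‖x‖ ^ 2 / (4 * t) by field_simp]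
    ring
  have e4 : (4 : ℝ) ^ (-(n : ℝ) / 2) / 4 ^ (-((n : ℝ) / 2 - β)) = 4 ^ (-β) := by
    rw [← rpow_sub (by norm_num)]
    congr 1
    ring
  rw [setIntegral_congr_fun measurableSet_Ioi e, integral_const_mul, h, heatConst, ← e4,
    div_rpow (by positivity) (by norm_num), ← rpow_natCast, ← rpow_mul hx'.le,
    mul_rpow (by norm_num) pi_pos.le,
    show ((2 : ℕ) : ℝ) * -((n : ℝ) / 2 - β) = 2 * β - n by push_cast; ring]
  ring

theorem integrableOn_rpow_mul_heatKernel {β : ℝ} (hβ : β < (n : ℝ) / 2)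
    {x : EuclideanSpace ℝ (Fin n)} (hx : x ≠ 0) :
    IntegrableOn (fun t : ℝ => t ^ (β - 1) * heatKernel n t x) (Ioi 0) := by
  refine Integrable.of_integral_ne_zero ?_
  rw [integral_rpow_mul_heatKernel hβ hx]
  have hx' : 0 < ‖x‖ := norm_pos_iff.2 hx
  have := heatConst_pos hβ
  positivity

theorem integral_heatKernel {t : ℝ} (ht : 0 < t) : ∫ x, heatKernel n t x = 1 := by
  have h := GaussianFourier.integral_rexp_neg_mul_sq_norm (V := EuclideanSpace ℝ (Fin n))
    (b := 1 / (4 * t)) (by positivity)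
  simp only [heatKernel]
  rw [integral_const_mul]
  have e : ∀ x : EuclideanSpace ℝ (Fin n), exp (-‖x‖ ^ 2 / (4 * t)) =
      exp (-(1 / (4 * t)) * ‖x‖ ^ 2) := fun x => by congr 1; field_simp
  simp only [e]
  rw [h, finrank_euclideanSpace_fin, show π / (1 / (4 * t)) = 4 * π * t by field_simp,
    ← rpow_add (by positivity)]
  ring_nf
  exact rpow_zero _

theorem integrable_heatKernel {t : ℝ} (ht : 0 < t) : Integrable (heatKernel n t) :=
  integrable_of_integral_eq_one (integral_heatKernel ht)

theorem heatKernel_mul_heatKernel {r t : ℝ} (hr : 0 < r) (ht : 0 < t)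
    (x y : EuclideanSpace ℝ (Fin n)) :
    heatKernel n r y * heatKernel n t (x - y) =
      heatKernel n (r + t) x * heatKernel n (r * t / (r + t)) (y - (r / (r + t)) • x) := by
  have hrt : 0 < r + t := by positivity
  simp only [heatKernel]
  have e : (4 * π * r) ^ (-(n : ℝ) / 2) * (4 * π * t) ^ (-(n : ℝ) / 2) =
      (4 * π * (r + t)) ^ (-(n : ℝ) / 2) * (4 * π * (r * t / (r + t))) ^ (-(n : ℝ) / 2) := by
    rw [← mul_rpow (by positivity) (by positivity), ← mul_rpow (by positivity) (by positivity)]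
    congr 1
    field_simp
  rw [mul_mul_mul_comm, ← exp_add, e, mul_mul_mul_comm, ← exp_add]
  congr 2
  rw [norm_sub_sq_real, norm_sub_sq_real, real_inner_smul_right, norm_smul, mul_pow,
    real_inner_comm, Real.norm_eq_abs, sq_abs]
  field_simp
  ring

theorem integral_heatKernel_mul_heatKernel {r t : ℝ} (hr : 0 < r) (ht : 0 < t)
    (x : EuclideanSpace ℝ (Fin n)) :
    ∫ y, heatKernel n r y * heatKernel n t (x - y) = heatKernel n (r + t) x := by
  simp only [heatKernel_mul_heatKernel hr ht]
  rw [integral_const_mul, integral_sub_right_eq_self (heatKernel n (r * t / (r + t))),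
    integral_heatKernel (by positivity), mul_one]

end HeatKernel

section PowerFunction

variable {n : ℕ}

theorem integrableOn_ball_norm_rpow (hn : 0 < n) {q : ℝ} (hq : -(n : ℝ) < q) (R : ℝ) :
    IntegrableOn (fun x : EuclideanSpace ℝ (Fin n) => ‖x‖ ^ q) (Metric.ball 0 R) := by
  have : Nonempty (Fin n) := ⟨⟨0, hn⟩⟩
  rw [integrableOn_fun_norm_addHaar volume (f := fun t : ℝ => t ^ q), finrank_euclideanSpace_fin]
  rcases le_or_gt R 0 with hR | hR
  · simp [Ioo_eq_empty_of_le hR]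
  refine IntegrableOn.congr_fun ((intervalIntegral.integrableOn_Ioo_rpow_iff
    (s := q + n - 1) hR).2 (by linarith)) (fun t ht => ?_) measurableSet_Ioo
  simp only [smul_eq_mul]
  rw [← rpow_natCast, ← rpow_add ht.1, Nat.cast_sub hn]
  congr 1
  push_cast
  ring

/-- The power `|x| ^ (-s)` cut off to the unit ball. -/
noncomputable def nearPow (n : ℕ) (s : ℝ) : EuclideanSpace ℝ (Fin n) → ℝ :=
  (Metric.ball 0 1).indicator fun x => ‖x‖ ^ (-s)

theorem integrable_nearPow (hn : 0 < n) {s : ℝ} (hs : s < n) : Integrable (nearPow n s) :=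
  (integrable_indicator_iff Metric.isOpen_ball.measurableSet).2
    (integrableOn_ball_norm_rpow hn (by linarith) 1)

theorem nearPow_nonneg (s : ℝ) (x : EuclideanSpace ℝ (Fin n)) : 0 ≤ nearPow n s x :=
  Set.indicator_nonneg (fun _ _ => by positivity) _

theorem norm_rpow_neg_le {s : ℝ} (hs : 0 ≤ s) (x : EuclideanSpace ℝ (Fin n)) :
    ‖x‖ ^ (-s) ≤ nearPow n s x + 1 := by
  by_cases h : x ∈ Metric.ball (0 : EuclideanSpace ℝ (Fin n)) 1
  · rw [nearPow, Set.indicator_of_mem h]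
    linarith
  · have h1 : 1 ≤ ‖x‖ := by simpa using h
    have := rpow_le_one_of_one_le_of_nonpos h1 (neg_nonpos.2 hs)
    linarith [nearPow_nonneg s x]

theorem integrable_norm_rpow_mul_heatKernel (hn : 0 < n) {s τ : ℝ} (hs : 0 ≤ s) (hsn : s < n)
    (hτ : 0 < τ) (x : EuclideanSpace ℝ (Fin n)) :
    Integrable fun y => ‖y‖ ^ (-s) * heatKernel n τ (x - y) := by
  have h : Integrable fun y => (4 * π * τ) ^ (-(n : ℝ) / 2) * nearPow n s y +
      heatKernel n τ (x - y) :=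
    ((integrable_nearPow hn hsn).const_mul _).add ((integrable_heatKernel hτ).comp_sub_left x)
  refine h.mono' ?_ (ae_of_all _ fun y => ?_)
  · have := (continuous_heatKernel (n := n) τ).measurable
    exact Measurable.aestronglyMeasurable (by fun_prop)
  · have h0 := heatKernel_pos (n := n) hτ (x - y)
    rw [Real.norm_of_nonneg (by positivity)]
    calc _ ≤ (nearPow n s y + 1) * heatKernel n τ (x - y) := by
          gcongr
          exact norm_rpow_neg_le hs y
      _ = nearPow n s y * heatKernel n τ (x - y) + heatKernel n τ (x - y) := by ring
      _ ≤ nearPow n s y * (4 * π * τ) ^ (-(n : ℝ) / 2) + heatKernel n τ (x - y) := by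
          gcongr
          · exact nearPow_nonneg s y
          · exact heatKernel_le hτ _
      _ = _ := by ring

theorem ae_ne_zero (hn : 0 < n) : ∀ᵐ x : EuclideanSpace ℝ (Fin n), x ≠ 0 := by
  have : Nonempty (Fin n) := ⟨⟨0, hn⟩⟩
  exact Measure.ae_ne volume 0

theorem integrable_rpow_mul_heatKernel_mul_heatKernel (hn : 0 < n) {β τ : ℝ} (hβ : 0 < β)
    (hβn : β < (n : ℝ) / 2) (hτ : 0 < τ) (x : EuclideanSpace ℝ (Fin n)) :
    Integrable (fun p : EuclideanSpace ℝ (Fin n) × ℝ =>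
      p.2 ^ (β - 1) * heatKernel n p.2 p.1 * heatKernel n τ (x - p.1))
      (volume.prod (volume.restrict (Ioi 0))) := by
  have hm : Measurable fun p : EuclideanSpace ℝ (Fin n) × ℝ =>
      p.2 ^ (β - 1) * heatKernel n p.2 p.1 * heatKernel n τ (x - p.1) := by
    have := (continuous_heatKernel (n := n) τ).measurable
    have := (measurable_heatKernel (n := n)).comp measurable_swap
    simp only [Function.comp_def, Prod.fst_swap, Prod.snd_swap] at this
    fun_prop
  rw [integrable_prod_iff hm.aestronglyMeasurable]
  constructor
  · filter_upwards [ae_ne_zero hn] with y hy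
    exact (integrableOn_rpow_mul_heatKernel hβn hy).mul_const _
  · refine ((integrable_norm_rpow_mul_heatKernel hn (s := n - 2 * β) (by linarith) (by linarith)
      hτ x).const_mul (heatConst n β)).congr ?_
    filter_upwards [ae_ne_zero hn] with y hy
    have e : ∀ r ∈ Ioi (0 : ℝ), ‖r ^ (β - 1) * heatKernel n r y * heatKernel n τ (x - y)‖ =
        r ^ (β - 1) * heatKernel n r y * heatKernel n τ (x - y) := by
      intro r (hr : 0 < r)
      have := heatKernel_pos hr y
      have := heatKernel_pos hτ (x - y)
      exact Real.norm_of_nonneg (by positivity)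
    rw [setIntegral_congr_fun measurableSet_Ioi e, integral_mul_const,
      integral_rpow_mul_heatKernel hβn hy, neg_sub]
    ring

theorem integral_rpow_mul_heatKernel_mul_heatKernel {β τ : ℝ} (hτ : 0 < τ)
    (x : EuclideanSpace ℝ (Fin n)) {r : ℝ} (hr : 0 < r) :
    ∫ y, r ^ (β - 1) * heatKernel n r y * heatKernel n τ (x - y) =
      r ^ (β - 1) * heatKernel n (r + τ) x := by
  simp only [mul_assoc]
  rw [integral_const_mul, integral_heatKernel_mul_heatKernel hr hτ]

theorem indicator_rpow_mul_heatKernel_sub {β τ : ℝ} (hτ : 0 < τ)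
    (x : EuclideanSpace ℝ (Fin n)) (r : ℝ) :
    (Ioi (0 : ℝ)).indicator (fun t => t ^ (β - 1) * heatKernel n (t + τ) x) (r - τ) =
      (Ioi (0 : ℝ)).indicator
        (fun t => (if τ < t then (t - τ) ^ (β - 1) else 0) * heatKernel n t x) r := by
  by_cases h : τ < r
  · rw [Set.indicator_of_mem (by simpa using h), Set.indicator_of_mem (by
      simpa using hτ.trans h), if_pos h, sub_add_cancel]
  · rw [Set.indicator_of_notMem (by simpa using h)]
    by_cases h0 : 0 < r
    · rw [Set.indicator_of_mem (by simpa using h0), if_neg h, zero_mul]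
    · rw [Set.indicator_of_notMem (by simpa using h0)]

theorem integrableOn_rpow_mul_heatKernel_add (hn : 0 < n) {β τ : ℝ} (hβ : 0 < β)
    (hβn : β < (n : ℝ) / 2) (hτ : 0 < τ) (x : EuclideanSpace ℝ (Fin n)) :
    IntegrableOn (fun r : ℝ => r ^ (β - 1) * heatKernel n (r + τ) x) (Ioi 0) := by
  have h := (integrable_rpow_mul_heatKernel_mul_heatKernel hn hβ hβn hτ x).integral_prod_right
  exact IntegrableOn.congr_fun h
    (fun r hr => integral_rpow_mul_heatKernel_mul_heatKernel hτ x hr) measurableSet_Ioi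

theorem integrableOn_shifted_rpow_mul_heatKernel (hn : 0 < n) {β τ : ℝ} (hβ : 0 < β)
    (hβn : β < (n : ℝ) / 2) (hτ : 0 < τ) (x : EuclideanSpace ℝ (Fin n)) :
    IntegrableOn (fun r : ℝ =>
      (if τ < r then (r - τ) ^ (β - 1) else 0) * heatKernel n r x) (Ioi 0) := by
  have h := ((integrable_indicator_iff measurableSet_Ioi).2
    (integrableOn_rpow_mul_heatKernel_add hn hβ hβn hτ x)).comp_sub_right τ
  simp only [indicator_rpow_mul_heatKernel_sub hτ] at h
  exact (integrable_indicator_iff measurableSet_Ioi).1 h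

theorem integral_norm_rpow_mul_heatKernel (hn : 0 < n) {β τ : ℝ} (hβ : 0 < β)
    (hβn : β < (n : ℝ) / 2) (hτ : 0 < τ) (x : EuclideanSpace ℝ (Fin n)) :
    heatConst n β * ∫ y, ‖y‖ ^ (2 * β - n) * heatKernel n τ (x - y) =
      ∫ r in Ioi (0 : ℝ), (if τ < r then (r - τ) ^ (β - 1) else 0) * heatKernel n r x := by
  have h := integral_integral_swap
    (f := fun (y : EuclideanSpace ℝ (Fin n)) (r : ℝ) =>
      r ^ (β - 1) * heatKernel n r y * heatKernel n τ (x - y))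
    (integrable_rpow_mul_heatKernel_mul_heatKernel hn hβ hβn hτ x)
  rw [setIntegral_congr_fun measurableSet_Ioi
    fun r hr => integral_rpow_mul_heatKernel_mul_heatKernel hτ x hr] at h
  rw [← integral_indicator measurableSet_Ioi]
  simp only [← indicator_rpow_mul_heatKernel_sub hτ]
  rw [integral_sub_right_eq_self
    ((Ioi (0 : ℝ)).indicator (fun t => t ^ (β - 1) * heatKernel n (t + τ) x)),
    integral_indicator measurableSet_Ioi, ← h, ← integral_const_mul]
  refine integral_congr_ae ?_
  filter_upwards [ae_ne_zero hn] with y hy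
  rw [integral_mul_const, integral_rpow_mul_heatKernel hβn hy]
  ring

/-- The heat semigroup acting on the power `|x| ^ (2 β - n)`. -/
theorem integral_norm_rpow_sub_mul_heatKernel (hn : 0 < n) {β τ : ℝ} (hβ : 0 < β)
    (hβn : β < (n : ℝ) / 2) (hτ : 0 < τ) {x : EuclideanSpace ℝ (Fin n)} (hx : x ≠ 0) :
    heatConst n β *
        ∫ y, (‖x‖ ^ (2 * β - n) - ‖y‖ ^ (2 * β - n)) * heatKernel n τ (x - y) =
      ∫ r in Ioi (0 : ℝ), powDiff β r τ * heatKernel n r x := by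
  have i2 := integrable_norm_rpow_mul_heatKernel hn (s := n - 2 * β) (by linarith)
    (by linarith) hτ x
  rw [neg_sub] at i2
  have i1 := ((integrable_heatKernel (n := n) hτ).comp_sub_left x).const_mul (‖x‖ ^ (2 * β - n))
  simp only [sub_mul, powDiff]
  rw [integral_sub i1 i2, integral_const_mul, integral_sub_left_eq_self (heatKernel n τ),
    integral_heatKernel hτ, mul_one, mul_sub, integral_norm_rpow_mul_heatKernel hn hβ hβn hτ,
    ← integral_rpow_mul_heatKernel hβn hx]
  exact (integral_sub (integrableOn_rpow_mul_heatKernel hβn hx)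
    (integrableOn_shifted_rpow_mul_heatKernel hn hβ hβn hτ x)).symm

end PowerFunction

section SesquilinearForm

variable {n : ℕ}

theorem integrable_mul_comp_sub {f k : EuclideanSpace ℝ (Fin n) → ℝ} (hf : Integrable f)
    (hk : Integrable k) :
    Integrable (fun p : EuclideanSpace ℝ (Fin n) × EuclideanSpace ℝ (Fin n) =>
      f p.1 * k (p.1 - p.2)) := by
  have h := (hf.convolution_integrand (ContinuousLinearMap.mul ℝ ℝ) hk.comp_neg).swap
  simp only [Function.comp_def, ContinuousLinearMap.mul_apply', Prod.fst_swap, Prod.snd_swap,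
    neg_sub] at h
  exact h

theorem integrable_indicator_mul_add {S : Set (EuclideanSpace ℝ (Fin n))} (hS : IsCompact S)
    {k h : EuclideanSpace ℝ (Fin n) → ℝ} (hk : Integrable k) (hh : Integrable h) :
    Integrable (fun p : EuclideanSpace ℝ (Fin n) × EuclideanSpace ℝ (Fin n) =>
      S.indicator 1 p.1 * (k (p.1 - p.2) + h p.2)) := by
  have h1 : Integrable (S.indicator (1 : EuclideanSpace ℝ (Fin n) → ℝ)) :=
    (integrable_indicator_iff hS.measurableSet).2 (integrableOn_const hS.measure_lt_top.ne)
  simp only [mul_add]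
  exact (integrable_mul_comp_sub h1 hk).add (h1.mul_prod hh)

theorem exists_pos_le_norm_of_zero_notMem_tsupport {φ : EuclideanSpace ℝ (Fin n) → ℝ}
    (h0 : (0 : EuclideanSpace ℝ (Fin n)) ∉ tsupport φ) :
    ∃ ρ > 0, ∀ x ∈ tsupport φ, 2 * ρ ≤ ‖x‖ := by
  obtain ⟨ε, hε, h⟩ := Metric.isOpen_iff.1 (isClosed_tsupport φ).isOpen_compl 0 h0
  refine ⟨ε / 2, by positivity, fun x hx => ?_⟩
  by_contra! hlt
  exact h (by simpa using (by linarith : ‖x‖ < ε)) hx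

theorem abs_rpow_neg_sub_rpow_neg_le {s ρ u v : ℝ} (hs : 0 ≤ s) (hρ : 0 < ρ) (hu : ρ ≤ u)
    (hv : ρ ≤ v) : |u ^ (-s) - v ^ (-s)| ≤ s * ρ ^ (-s - 1) * |u - v| := by
  have h := Convex.norm_image_sub_le_of_norm_hasDerivWithin_le (𝕜 := ℝ) (s := Ici ρ)
    (f := fun t : ℝ => t ^ (-s)) (f' := fun t => -s * t ^ (-s - 1)) (C := s * ρ ^ (-s - 1))
    (fun t ht => (hasDerivAt_rpow_const (Or.inl (hρ.trans_le ht).ne')).hasDerivWithinAt)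
    (fun t ht => ?_) (convex_Ici ρ) hv hu
  · simpa using h
  · have ht0 : 0 < t := hρ.trans_le ht
    rw [norm_mul, norm_neg, Real.norm_of_nonneg hs, Real.norm_of_nonneg (by positivity)]
    exact mul_le_mul_of_nonneg_left (rpow_le_rpow_of_nonpos hρ ht (by linarith)) hs

/-- An integrable majorant of `|φ x - φ y| |x - y| ^ (-(n + a))` in `z = x - y`
when `φ` is regular on the scale `ρ`. -/
noncomputable def formMajorant (n : ℕ) (a ρ C D : ℝ) (z : EuclideanSpace ℝ (Fin n)) : ℝ :=
  (Metric.ball 0 ρ).indicator (fun z => C * ‖z‖ ^ (2 - n - a)) z +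
    D * (ρ / (1 + ρ)) ^ (-(n + a)) * (1 + ‖z‖) ^ (-(n + a))

theorem integrable_formMajorant (hn : 0 < n) {a : ℝ} (ha : a ∈ Ioo (0 : ℝ) 2) (ρ C D : ℝ) :
    Integrable (formMajorant n a ρ C D) := by
  refine Integrable.add ?_ (Integrable.const_mul ?_ _)
  · exact (integrable_indicator_iff Metric.isOpen_ball.measurableSet).2
      ((integrableOn_ball_norm_rpow hn (by linarith [ha.2]) ρ).const_mul C)
  · exact integrable_one_add_norm (by rw [finrank_euclideanSpace_fin]; linarith [ha.1])

theorem abs_form_integrand_le {φ : EuclideanSpace ℝ (Fin n) → ℝ} {s a ρ M L : ℝ} (hs : 0 ≤ s)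
    (ha : 0 ≤ a) (hρ : 0 < ρ) (hM : ∀ x, |φ x| ≤ M) (hL : 0 ≤ L)
    (hφ : ∀ x y, |φ x - φ y| ≤ L * ‖x - y‖) {x : EuclideanSpace ℝ (Fin n)}
    (hx : 2 * ρ ≤ ‖x‖) (y : EuclideanSpace ℝ (Fin n)) :
    |(φ x - φ y) * (‖x‖ ^ (-s) - ‖y‖ ^ (-s)) * ‖x - y‖ ^ (-(n + a))| ≤
      formMajorant n a ρ (L * (s * ρ ^ (-s - 1))) (2 * M * (ρ ^ (-s) + 1)) (x - y) +
        2 * M * ρ ^ (-(n + a)) * nearPow n s y := by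
  have hM0 : 0 ≤ M := (abs_nonneg _).trans (hM 0)
  have hN := nearPow_nonneg (n := n) s y
  have hn0 : (0 : ℝ) ≤ n := Nat.cast_nonneg n
  rw [abs_mul, abs_mul, abs_of_nonneg (by positivity : 0 ≤ ‖x - y‖ ^ (-(n + a))), formMajorant]
  rcases lt_or_ge ‖x - y‖ ρ with hz | hz
  · rw [Set.indicator_of_mem (by simpa using hz)]
    have hy : ρ ≤ ‖y‖ := by
      have := norm_sub_norm_le x y
      linarith
    have h1 := abs_rpow_neg_sub_rpow_neg_le hs hρ (by linarith : ρ ≤ ‖x‖) hy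
    have h2 := abs_norm_sub_norm_le x y
    have h3 : |‖x‖ ^ (-s) - ‖y‖ ^ (-s)| ≤ s * ρ ^ (-s - 1) * ‖x - y‖ :=
      h1.trans (by gcongr)
    have h4 : L * (s * ρ ^ (-s - 1)) * (‖x - y‖ ^ 2 * ‖x - y‖ ^ (-(n + a))) ≤
        L * (s * ρ ^ (-s - 1)) * ‖x - y‖ ^ (2 - n - a) := by
      refine mul_le_mul_of_nonneg_left ?_ (by positivity)
      rcases (norm_nonneg (x - y)).eq_or_lt with h | h
      · rw [← h]
        simp only [ne_eq, OfNat.ofNat_ne_zero, not_false_eq_true, zero_pow, zero_mul]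
        positivity
      · rw [← rpow_natCast, ← rpow_add h]
        apply le_of_eq
        congr 1
        push_cast
        ring
    calc _ ≤ (L * ‖x - y‖) * (s * ρ ^ (-s - 1) * ‖x - y‖) * ‖x - y‖ ^ (-(n + a)) := by
          gcongr
          exact hφ x y
      _ = L * (s * ρ ^ (-s - 1)) * (‖x - y‖ ^ 2 * ‖x - y‖ ^ (-(n + a))) := by ring
      _ ≤ _ := h4
      _ ≤ _ := by
          rw [add_assoc]
          exact le_add_of_nonneg_right (by positivity)
  · rw [Set.indicator_of_notMem (by simpa using hz), zero_add]
    have hz0 : 0 < ‖x - y‖ := hρ.trans_le hz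
    have h1 : |φ x - φ y| ≤ 2 * M := by
      have := abs_sub (φ x) (φ y)
      linarith [hM x, hM y]
    have h2 : |‖x‖ ^ (-s) - ‖y‖ ^ (-s)| ≤ (ρ ^ (-s) + 1) + nearPow n s y := by
      have e1 : ‖x‖ ^ (-s) ≤ ρ ^ (-s) :=
        rpow_le_rpow_of_nonpos hρ (by linarith) (neg_nonpos.2 hs)
      have e2 := norm_rpow_neg_le hs y
      have e3 := abs_sub (‖x‖ ^ (-s)) (‖y‖ ^ (-s))
      rw [abs_of_nonneg (a := ‖x‖ ^ (-s)) (by positivity),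
        abs_of_nonneg (a := ‖y‖ ^ (-s)) (by positivity)] at e3
      linarith
    have h3 : ‖x - y‖ ^ (-(n + a)) ≤ ρ ^ (-(n + a)) :=
      rpow_le_rpow_of_nonpos hρ hz (by linarith)
    have h4 : ‖x - y‖ ^ (-(n + a)) ≤
        (ρ / (1 + ρ)) ^ (-(n + a)) * (1 + ‖x - y‖) ^ (-(n + a)) := by
      rw [← mul_rpow (by positivity) (by positivity)]
      refine rpow_le_rpow_of_nonpos (by positivity) ?_ (by linarith)
      rw [div_mul_eq_mul_div, div_le_iff₀ (by positivity)]
      linarith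
    calc _ ≤ 2 * M * ((ρ ^ (-s) + 1) + nearPow n s y) * ‖x - y‖ ^ (-(n + a)) := by gcongr
      _ = 2 * M * (ρ ^ (-s) + 1) * ‖x - y‖ ^ (-(n + a)) +
          2 * M * nearPow n s y * ‖x - y‖ ^ (-(n + a)) := by ring
      _ ≤ 2 * M * (ρ ^ (-s) + 1) *
            ((ρ / (1 + ρ)) ^ (-(n + a)) * (1 + ‖x - y‖) ^ (-(n + a))) +
          2 * M * nearPow n s y * ρ ^ (-(n + a)) := by gcongr
      _ = _ := by ring

theorem integrable_form_integrand (hn : 0 < n) {φ : EuclideanSpace ℝ (Fin n) → ℝ} {s a : ℝ}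
    (hs : 0 ≤ s) (hsn : s < n) (ha : a ∈ Ioo (0 : ℝ) 2) {K : NNReal} (hφ : LipschitzWith K φ)
    (hc : HasCompactSupport φ) (h0 : (0 : EuclideanSpace ℝ (Fin n)) ∉ tsupport φ) :
    Integrable (fun p : EuclideanSpace ℝ (Fin n) × EuclideanSpace ℝ (Fin n) =>
      (φ p.1 - φ p.2) * (‖p.1‖ ^ (-s) - ‖p.2‖ ^ (-s)) * ‖p.1 - p.2‖ ^ (-(n + a))) := by
  obtain ⟨ρ, hρ, hsupp⟩ := exists_pos_le_norm_of_zero_notMem_tsupport h0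
  obtain ⟨M, hM⟩ := hc.exists_bound_of_continuous hφ.continuous
  have hL : ∀ x y, |φ x - φ y| ≤ K * ‖x - y‖ := fun x y => by
    simpa [Real.dist_eq, dist_eq_norm] using hφ.dist_le_mul x y
  have hB := integrable_indicator_mul_add hc
    (integrable_formMajorant hn ha ρ (K * (s * ρ ^ (-s - 1))) (2 * M * (ρ ^ (-s) + 1)))
    ((integrable_nearPow hn hsn).const_mul (2 * M * ρ ^ (-(n + a))))
  have hm := hφ.continuous.measurable
  have hM0 : 0 ≤ M := (norm_nonneg _).trans (hM 0)
  have hnn : ∀ z y : EuclideanSpace ℝ (Fin n), 0 ≤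
      formMajorant n a ρ (K * (s * ρ ^ (-s - 1))) (2 * M * (ρ ^ (-s) + 1)) z +
        2 * M * ρ ^ (-(n + a)) * nearPow n s y := fun z y => by
    have h1 := nearPow_nonneg (n := n) s y
    have h2 : 0 ≤ (Metric.ball 0 ρ).indicator
        (fun z : EuclideanSpace ℝ (Fin n) => K * (s * ρ ^ (-s - 1)) * ‖z‖ ^ (2 - n - a)) z :=
      Set.indicator_nonneg (fun _ _ => by positivity) _
    unfold formMajorant
    positivity
  refine (hB.add hB.swap).mono' (Measurable.aestronglyMeasurable (by fun_prop))
    (ae_of_all _ fun ⟨x, y⟩ => ?_)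
  have hi : ∀ x : EuclideanSpace ℝ (Fin n), 0 ≤
      (tsupport φ).indicator (1 : EuclideanSpace ℝ (Fin n) → ℝ) x :=
    fun x => Set.indicator_nonneg (fun _ _ => by simp) _
  simp only [Pi.add_apply, Function.comp_apply, Prod.swap_prod_mk, Real.norm_eq_abs]
  by_cases hx : x ∈ tsupport φ
  · rw [Set.indicator_of_mem hx, Pi.one_apply, one_mul]
    exact (abs_form_integrand_le hs ha.1.le hρ hM K.2 hL (hsupp x hx) y).trans
      (le_add_of_nonneg_right (mul_nonneg (hi y) (hnn _ _)))
  by_cases hy : y ∈ tsupport φ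
  · rw [Set.indicator_of_mem hy, Pi.one_apply, one_mul]
    have h := abs_form_integrand_le hs ha.1.le hρ hM K.2 hL (hsupp y hy) x
    rw [norm_sub_rev y x, ← neg_sub (φ x), ← neg_sub (‖x‖ ^ (-s)), neg_mul_neg] at h
    exact h.trans (le_add_of_nonneg_left (mul_nonneg (hi x) (hnn _ _)))
  · rw [image_eq_zero_of_notMem_tsupport hx, image_eq_zero_of_notMem_tsupport hy, sub_self,
      zero_mul, zero_mul, abs_zero]
    exact add_nonneg (mul_nonneg (hi _) (hnn _ _)) (mul_nonneg (hi _) (hnn _ _))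

theorem integrable_mul_sub_mul_heatKernel (hn : 0 < n) {φ : EuclideanSpace ℝ (Fin n) → ℝ}
    {s τ : ℝ} (hs : 0 ≤ s) (hsn : s < n) (hτ : 0 < τ) (hφ : Continuous φ)
    (hc : HasCompactSupport φ) (h0 : (0 : EuclideanSpace ℝ (Fin n)) ∉ tsupport φ) :
    Integrable (fun p : EuclideanSpace ℝ (Fin n) × EuclideanSpace ℝ (Fin n) =>
      φ p.1 * ((‖p.1‖ ^ (-s) - ‖p.2‖ ^ (-s)) * heatKernel n τ (p.1 - p.2))) := by
  obtain ⟨ρ, hρ, hsupp⟩ := exists_pos_le_norm_of_zero_notMem_tsupport h0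
  obtain ⟨M, hM⟩ := hc.exists_bound_of_continuous hφ
  have hM0 : 0 ≤ M := (norm_nonneg _).trans (hM 0)
  have hB := integrable_indicator_mul_add hc
    ((integrable_heatKernel (n := n) hτ).const_mul (M * (ρ ^ (-s) + 1)))
    ((integrable_nearPow hn hsn).const_mul (M * (4 * π * τ) ^ (-(n : ℝ) / 2)))
  have hm := hφ.measurable
  have hm' := (continuous_heatKernel (n := n) τ).measurable
  refine hB.mono' (Measurable.aestronglyMeasurable (by fun_prop)) (ae_of_all _ fun ⟨x, y⟩ => ?_)
  simp only
  by_cases hx : x ∈ tsupport φ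
  · rw [Set.indicator_of_mem hx, Pi.one_apply, one_mul, norm_mul, norm_mul]
    have hN := nearPow_nonneg (n := n) s y
    have hp := heatKernel_pos hτ (x - y)
    have e1 : ‖x‖ ^ (-s) ≤ ρ ^ (-s) :=
      rpow_le_rpow_of_nonpos hρ (by linarith [hsupp x hx]) (neg_nonpos.2 hs)
    have e2 := norm_rpow_neg_le hs y
    have e3 := abs_sub (‖x‖ ^ (-s)) (‖y‖ ^ (-s))
    rw [abs_of_nonneg (a := ‖x‖ ^ (-s)) (by positivity),
        abs_of_nonneg (a := ‖y‖ ^ (-s)) (by positivity)] at e3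
    have e4 : ‖‖x‖ ^ (-s) - ‖y‖ ^ (-s)‖ ≤ (ρ ^ (-s) + 1) + nearPow n s y := by
      rw [Real.norm_eq_abs]
      linarith
    rw [Real.norm_of_nonneg hp.le]
    calc _ ≤ M * (((ρ ^ (-s) + 1) + nearPow n s y) * heatKernel n τ (x - y)) := by
          gcongr
          exact hM x
      _ = M * (ρ ^ (-s) + 1) * heatKernel n τ (x - y) +
          M * nearPow n s y * heatKernel n τ (x - y) := by ring
      _ ≤ M * (ρ ^ (-s) + 1) * heatKernel n τ (x - y) +
          M * nearPow n s y * (4 * π * τ) ^ (-(n : ℝ) / 2) := by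
          gcongr
          exact heatKernel_le hτ _
      _ = _ := by ring
  · rw [Set.indicator_of_notMem hx, image_eq_zero_of_notMem_tsupport hx]
    simp

theorem integral_form_heatKernel (hn : 0 < n) {φ : EuclideanSpace ℝ (Fin n) → ℝ}
    {s τ : ℝ} (hs : 0 ≤ s) (hsn : s < n) (hτ : 0 < τ) (hφ : Continuous φ)
    (hc : HasCompactSupport φ) (h0 : (0 : EuclideanSpace ℝ (Fin n)) ∉ tsupport φ) :
    ∫ p : EuclideanSpace ℝ (Fin n) × EuclideanSpace ℝ (Fin n),
        (φ p.1 - φ p.2) * (‖p.1‖ ^ (-s) - ‖p.2‖ ^ (-s)) * heatKernel n τ (p.1 - p.2) =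
      2 * ∫ x, φ x * ∫ y, (‖x‖ ^ (-s) - ‖y‖ ^ (-s)) * heatKernel n τ (x - y) := by
  have hP := integrable_mul_sub_mul_heatKernel hn hs hsn hτ hφ hc h0
  have e : ∀ p : EuclideanSpace ℝ (Fin n) × EuclideanSpace ℝ (Fin n),
      (φ p.1 - φ p.2) * (‖p.1‖ ^ (-s) - ‖p.2‖ ^ (-s)) * heatKernel n τ (p.1 - p.2) =
        φ p.1 * ((‖p.1‖ ^ (-s) - ‖p.2‖ ^ (-s)) * heatKernel n τ (p.1 - p.2)) +
        φ p.2 * ((‖p.2‖ ^ (-s) - ‖p.1‖ ^ (-s)) * heatKernel n τ (p.2 - p.1)) := by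
    intro p
    rw [heatKernel_sub_comm τ p.2 p.1]
    ring
  have h2 := integral_prod_swap (μ := (volume : Measure (EuclideanSpace ℝ (Fin n))))
    (ν := (volume : Measure (EuclideanSpace ℝ (Fin n))))
    (fun p : EuclideanSpace ℝ (Fin n) × EuclideanSpace ℝ (Fin n) =>
      φ p.1 * ((‖p.1‖ ^ (-s) - ‖p.2‖ ^ (-s)) * heatKernel n τ (p.1 - p.2)))
  simp only [Prod.fst_swap, Prod.snd_swap] at h2
  have hP' := hP.swap
  simp only [Function.comp_def, Prod.fst_swap, Prod.snd_swap] at hP'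
  simp only [e]
  rw [integral_add hP hP', Measure.volume_eq_prod, h2, integral_prod _ hP, ← two_mul]
  simp only [integral_const_mul]

end SesquilinearForm

section Subordination

variable {n : ℕ}

theorem integral_mul_norm_rpow_eq_integral_heatKernel {a : ℝ} (ha : 0 ≤ a)
    {G : EuclideanSpace ℝ (Fin n) × EuclideanSpace ℝ (Fin n) → ℝ} (hG : Measurable G)
    (hdiag : ∀ x, G (x, x) = 0) (hi : Integrable fun p => G p * ‖p.1 - p.2‖ ^ (-(n + a))) :
    heatConst n (-a / 2) * ∫ p, G p * ‖p.1 - p.2‖ ^ (-(n + a)) =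
      ∫ τ in Ioi (0 : ℝ), τ ^ (-a / 2 - 1) * ∫ p, G p * heatKernel n τ (p.1 - p.2) := by
  have hn0 : (0 : ℝ) ≤ n := Nat.cast_nonneg n
  rcases hn0.eq_or_lt with hn | hn
  · have : n = 0 := by exact_mod_cast hn.symm
    subst this
    have h : ∀ p, G p = 0 := fun p => by
      rw [← hdiag p.1]
      exact congrArg G (Prod.ext rfl (Subsingleton.elim _ _))
    simp [h]
  have hlt : -a / 2 < (n : ℝ) / 2 := by linarith
  have hc := heatConst_pos hlt
  have hm : Measurable fun q : (EuclideanSpace ℝ (Fin n) × EuclideanSpace ℝ (Fin n)) × ℝ =>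
      G q.1 * (q.2 ^ (-a / 2 - 1) * heatKernel n q.2 (q.1.1 - q.1.2)) := by
    have h : Measurable fun q : (EuclideanSpace ℝ (Fin n) × EuclideanSpace ℝ (Fin n)) × ℝ =>
        heatKernel n q.2 (q.1.1 - q.1.2) :=
      (measurable_heatKernel (n := n)).comp (by fun_prop :
        Measurable fun q : (EuclideanSpace ℝ (Fin n) × EuclideanSpace ℝ (Fin n)) × ℝ =>
          (q.2, q.1.1 - q.1.2))
    fun_prop
  have hval : ∀ p, ∫ τ in Ioi (0 : ℝ), G p * (τ ^ (-a / 2 - 1) * heatKernel n τ (p.1 - p.2)) =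
      heatConst n (-a / 2) * (G p * ‖p.1 - p.2‖ ^ (-(n + a))) := by
    rintro ⟨x, y⟩
    rcases eq_or_ne x y with rfl | hxy
    · simp [hdiag]
    · rw [integral_const_mul, integral_rpow_mul_heatKernel hlt (sub_ne_zero.2 hxy),
        show 2 * (-a / 2) - n = -(n + a) by ring]
      ring
  have hint : Integrable
      (fun q : (EuclideanSpace ℝ (Fin n) × EuclideanSpace ℝ (Fin n)) × ℝ =>
        G q.1 * (q.2 ^ (-a / 2 - 1) * heatKernel n q.2 (q.1.1 - q.1.2)))
      (volume.prod (volume.restrict (Ioi 0))) := by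
    rw [integrable_prod_iff hm.aestronglyMeasurable]
    constructor
    · refine ae_of_all _ fun ⟨x, y⟩ => ?_
      rcases eq_or_ne x y with rfl | hxy
      · simp [hdiag]
      · exact (integrableOn_rpow_mul_heatKernel hlt (sub_ne_zero.2 hxy)).const_mul (G (x, y))
    · refine (hi.norm.const_mul (heatConst n (-a / 2))).congr (ae_of_all _ fun ⟨x, y⟩ => ?_)
      simp only
      rcases eq_or_ne x y with rfl | hxy
      · simp [hdiag]
      · have e : ∀ τ ∈ Ioi (0 : ℝ), ‖G (x, y) * (τ ^ (-a / 2 - 1) * heatKernel n τ (x - y))‖ =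
            |G (x, y)| * (τ ^ (-a / 2 - 1) * heatKernel n τ (x - y)) := by
          intro τ (hτ : 0 < τ)
          have := heatKernel_pos hτ (x - y)
          rw [norm_mul, Real.norm_of_nonneg (r := τ ^ (-a / 2 - 1) * _) (by positivity),
            Real.norm_eq_abs]
        rw [setIntegral_congr_fun measurableSet_Ioi e, integral_const_mul,
          integral_rpow_mul_heatKernel hlt (sub_ne_zero.2 hxy),
          show 2 * (-a / 2) - n = -(n + a) by ring, norm_mul,
          Real.norm_of_nonneg (r := ‖x - y‖ ^ (-(n + a))) (by positivity), Real.norm_eq_abs]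
        ring
  have h := integral_integral_swap (f := fun p τ =>
    G p * (τ ^ (-a / 2 - 1) * heatKernel n τ (p.1 - p.2))) hint
  simp only [hval] at h
  rw [← integral_const_mul, h]
  congr 1
  ext τ
  rw [← integral_const_mul]
  congr 1
  ext p
  ring

theorem measurable_powDiff (β : ℝ) : Measurable fun q : ℝ × ℝ => powDiff β q.1 q.2 := by
  unfold powDiff
  refine Measurable.sub (by fun_prop) (Measurable.ite ?_ (by fun_prop) measurable_const)
  exact measurableSet_lt measurable_snd measurable_fst

theorem integrable_rpow_mul_heatKernel_of_integrable (hn : 0 < n) {a β : ℝ}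
    (ha : a ∈ Ioo (0 : ℝ) 2) (hβn : β < (n : ℝ) / 2)
    {φ : EuclideanSpace ℝ (Fin n) → ℝ} (hφ : Measurable φ)
    (hi : Integrable fun x => φ x * ‖x‖ ^ (2 * (β - a / 2) - n)) :
    Integrable (fun q : EuclideanSpace ℝ (Fin n) × ℝ =>
        φ q.1 * (q.2 ^ (β - a / 2 - 1) * heatKernel n q.2 q.1))
      (volume.prod (volume.restrict (Ioi 0))) := by
  have hlt : β - a / 2 < (n : ℝ) / 2 := by linarith [ha.1]
  have hm : Measurable fun q : EuclideanSpace ℝ (Fin n) × ℝ =>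
      φ q.1 * (q.2 ^ (β - a / 2 - 1) * heatKernel n q.2 q.1) := by
    have := (measurable_heatKernel (n := n)).comp measurable_swap
    simp only [Function.comp_def, Prod.fst_swap, Prod.snd_swap] at this
    fun_prop
  rw [integrable_prod_iff hm.aestronglyMeasurable]
  constructor
  · filter_upwards [ae_ne_zero hn] with x hx
    exact (integrableOn_rpow_mul_heatKernel hlt hx).const_mul _
  · refine (hi.norm.const_mul (heatConst n (β - a / 2))).congr ?_
    filter_upwards [ae_ne_zero hn] with x hx
    have e : ∀ r ∈ Ioi (0 : ℝ), ‖φ x * (r ^ (β - a / 2 - 1) * heatKernel n r x)‖ =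
        |φ x| * (r ^ (β - a / 2 - 1) * heatKernel n r x) := by
      intro r (hr : 0 < r)
      have := heatKernel_pos hr x
      rw [norm_mul, Real.norm_of_nonneg (r := r ^ (β - a / 2 - 1) * _) (by positivity),
        Real.norm_eq_abs]
    rw [setIntegral_congr_fun measurableSet_Ioi e, integral_const_mul,
      integral_rpow_mul_heatKernel hlt hx, norm_mul,
      Real.norm_of_nonneg (r := ‖x‖ ^ (2 * (β - a / 2) - n)) (by positivity), Real.norm_eq_abs]
    ring

theorem integral_rpow_mul_integral_powDiff (hn : 0 < n) {a β : ℝ}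
    (ha : a ∈ Ioo (0 : ℝ) 2) (hβ : a / 2 < β) (hβn : β < (n : ℝ) / 2)
    {φ : EuclideanSpace ℝ (Fin n) → ℝ} (hφ : Measurable φ)
    (hi : Integrable fun x => φ x * ‖x‖ ^ (2 * (β - a / 2) - n)) :
    ∫ τ in Ioi (0 : ℝ), τ ^ (-a / 2 - 1) *
        ∫ x, φ x * ∫ r in Ioi (0 : ℝ), powDiff β r τ * heatKernel n r x =
      Gamma β / Gamma (β - a / 2) * |Gamma (-a / 2)| * heatConst n (β - a / 2) *
        ∫ x, φ x * ‖x‖ ^ (2 * (β - a / 2) - n) := by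
  have hlt : β - a / 2 < (n : ℝ) / 2 := by linarith [ha.1]
  have hV := integrable_rpow_mul_heatKernel_of_integrable hn ha hβn hφ hi
  have hpos : ∀ᵐ q : EuclideanSpace ℝ (Fin n) × ℝ ∂(volume.prod (volume.restrict (Ioi 0))),
      0 < q.2 :=
    Measure.quasiMeasurePreserving_snd.ae (ae_restrict_mem measurableSet_Ioi)
  have hm : Measurable fun q : (EuclideanSpace ℝ (Fin n) × ℝ) × ℝ =>
      φ q.1.1 * heatKernel n q.1.2 q.1.1 * (q.2 ^ (-a / 2 - 1) * powDiff β q.1.2 q.2) := by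
    have h1 := (measurable_heatKernel (n := n)).comp measurable_swap
    simp only [Function.comp_def, Prod.fst_swap, Prod.snd_swap] at h1
    have h2 : Measurable fun q : (EuclideanSpace ℝ (Fin n) × ℝ) × ℝ => powDiff β q.1.2 q.2 :=
      (measurable_powDiff β).comp (by fun_prop :
        Measurable fun q : (EuclideanSpace ℝ (Fin n) × ℝ) × ℝ => (q.1.2, q.2))
    have h3 : Measurable fun q : (EuclideanSpace ℝ (Fin n) × ℝ) × ℝ =>
      heatKernel n q.1.2 q.1.1 := h1.comp measurable_fst
    fun_prop
  have hW : Integrable (fun q : (EuclideanSpace ℝ (Fin n) × ℝ) × ℝ =>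
      φ q.1.1 * heatKernel n q.1.2 q.1.1 * (q.2 ^ (-a / 2 - 1) * powDiff β q.1.2 q.2))
      ((volume.prod (volume.restrict (Ioi 0))).prod (volume.restrict (Ioi 0))) := by
    rw [integrable_prod_iff hm.aestronglyMeasurable]
    constructor
    · filter_upwards [hpos] with q hq
      exact (integrableOn_rpow_mul_powDiff ha hβ hq).const_mul _
    · refine (hV.norm.const_mul
        (∫ x in Ioi (0 : ℝ), |x ^ (-a / 2 - 1) * powDiff β 1 x|)).congr ?_
      filter_upwards [hpos] with q hq
      have h := integral_abs_rpow_mul_powDiff a β hq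
      have hk := heatKernel_pos hq q.1
      simp only [← Real.norm_eq_abs] at h ⊢
      simp only [norm_mul (φ q.1 * _)]
      rw [integral_const_mul, h, norm_mul (φ q.1), norm_mul (φ q.1), norm_mul _ (heatKernel _ _ _),
        Real.norm_of_nonneg (r := q.2 ^ (β - a / 2 - 1)) (by positivity)]
      ring
  have hswap := integral_integral_swap (f := fun (q : EuclideanSpace ℝ (Fin n) × ℝ) τ =>
    φ q.1 * heatKernel n q.2 q.1 * (τ ^ (-a / 2 - 1) * powDiff β q.2 τ)) hW
  have hL : ∫ q : EuclideanSpace ℝ (Fin n) × ℝ, (∫ τ in Ioi (0 : ℝ),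
        φ q.1 * heatKernel n q.2 q.1 * (τ ^ (-a / 2 - 1) * powDiff β q.2 τ))
          ∂(volume.prod (volume.restrict (Ioi 0))) =
      Gamma β / Gamma (β - a / 2) * |Gamma (-a / 2)| * heatConst n (β - a / 2) *
        ∫ x, φ x * ‖x‖ ^ (2 * (β - a / 2) - n) := by
    have e : (fun q : EuclideanSpace ℝ (Fin n) × ℝ => ∫ τ in Ioi (0 : ℝ),
          φ q.1 * heatKernel n q.2 q.1 * (τ ^ (-a / 2 - 1) * powDiff β q.2 τ))
        =ᵐ[volume.prod (volume.restrict (Ioi 0))]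
        fun q => Gamma β / Gamma (β - a / 2) * |Gamma (-a / 2)| *
          (φ q.1 * (q.2 ^ (β - a / 2 - 1) * heatKernel n q.2 q.1)) := by
      filter_upwards [hpos] with q hq
      rw [integral_const_mul, integral_rpow_mul_powDiff a β hq,
        integral_rpow_mul_powDiff_one ha hβ]
      ring
    rw [integral_congr_ae e, integral_const_mul, integral_prod _ hV,
      mul_assoc _ (heatConst n (β - a / 2)), ← integral_const_mul (heatConst n _)]
    congr 1
    refine integral_congr_ae ?_
    filter_upwards [ae_ne_zero hn] with x hx
    rw [integral_const_mul, integral_rpow_mul_heatKernel hlt hx]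
    ring
  rw [← hL, hswap]
  refine integral_congr_ae ?_
  filter_upwards [hW.prod_left_ae] with τ hτ
  rw [integral_prod _ hτ, ← integral_const_mul]
  congr 1
  ext x
  rw [← integral_const_mul, ← integral_const_mul]
  congr 1
  ext r
  ring

/-- The form of `|p| ^ a` on a pair `(φ, |x| ^ (2 β - n))`. -/
theorem integral_form_norm_rpow (hn : 0 < n) {a β : ℝ} (ha : a ∈ Ioo (0 : ℝ) 2)
    (hβ : a / 2 < β) (hβn : β < (n : ℝ) / 2) {φ : EuclideanSpace ℝ (Fin n) → ℝ} {K : NNReal}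
    (hφ : LipschitzWith K φ) (hc : HasCompactSupport φ)
    (h0 : (0 : EuclideanSpace ℝ (Fin n)) ∉ tsupport φ) :
    heatConst n β * (heatConst n (-a / 2) *
        ∫ p : EuclideanSpace ℝ (Fin n) × EuclideanSpace ℝ (Fin n),
          (φ p.1 - φ p.2) * (‖p.1‖ ^ (2 * β - n) - ‖p.2‖ ^ (2 * β - n)) *
            ‖p.1 - p.2‖ ^ (-(n + a))) =
      2 * (Gamma β / Gamma (β - a / 2) * |Gamma (-a / 2)| * heatConst n (β - a / 2) *
        ∫ x, φ x * ‖x‖ ^ (2 * (β - a / 2) - n)) := by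
  have hβ0 : 0 < β := by linarith [ha.1]
  have hs : 0 ≤ (n : ℝ) - 2 * β := by linarith
  have hsn : (n : ℝ) - 2 * β < n := by linarith
  have hm := hφ.continuous.measurable
  have hi : Integrable fun x => φ x * ‖x‖ ^ (2 * (β - a / 2) - n) := by
    refine Continuous.integrable_of_hasCompactSupport ?_ hc.mul_right
    refine continuous_iff_continuousAt.2 fun x => ?_
    by_cases hx : x ∈ tsupport φ
    · have hx0 : x ≠ 0 := fun h => h0 (h ▸ hx)
      exact hφ.continuous.continuousAt.mul
        (continuous_norm.continuousAt.rpow_const (Or.inl (norm_ne_zero_iff.2 hx0)))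
    · refine (continuousAt_const (y := (0 : ℝ))).congr ?_
      filter_upwards [notMem_tsupport_iff_eventuallyEq.1 hx] with y hy
      simp [hy]
  have hF := integrable_form_integrand hn hs hsn ha hφ hc h0
  rw [neg_sub] at hF
  rw [integral_mul_norm_rpow_eq_integral_heatKernel ha.1.le (by fun_prop) (by simp) hF,
    ← integral_rpow_mul_integral_powDiff hn ha hβ hβn hm hi, ← integral_const_mul,
    ← integral_const_mul]
  refine setIntegral_congr_fun measurableSet_Ioi fun τ (hτ : 0 < τ) => ?_
  have h := integral_form_heatKernel hn hs hsn hτ hφ.continuous hc h0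
  rw [neg_sub] at h
  have h2 : heatConst n β *
      ∫ x, φ x * ∫ y, (‖x‖ ^ (2 * β - n) - ‖y‖ ^ (2 * β - n)) * heatKernel n τ (x - y) =
      ∫ x, φ x * ∫ r in Ioi (0 : ℝ), powDiff β r τ * heatKernel n r x := by
    rw [← integral_const_mul]
    refine integral_congr_ae ?_
    filter_upwards [ae_ne_zero hn] with x hx
    rw [← integral_norm_rpow_sub_mul_heatKernel hn hβ0 hβn hτ hx]
    ring
  rw [h, ← h2]
  ring

end Subordination

section Evaluation

variable {n : ℕ}

theorem four_rpow_half (a : ℝ) : (4 : ℝ) ^ (a / 2) = 2 ^ a := by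
  rw [show (4 : ℝ) = 2 ^ (2 : ℝ) by norm_num, ← rpow_mul (by norm_num)]
  congr 1
  ring

theorem abs_Gamma_neg_half_pos {a : ℝ} (ha : a ∈ Ioo (0 : ℝ) 2) : 0 < |Gamma (-a / 2)| := by
  have h0 := ha.1
  have := Gamma_pos_of_pos (show 0 < 1 - a / 2 by linarith [ha.2])
  rw [abs_Gamma_neg_half ha]
  positivity

theorem heatConst_neg_half (n : ℕ) {a : ℝ} (ha : a ∈ Ioo (0 : ℝ) 2) :
    heatConst n (-a / 2) = 2 * |Gamma (-a / 2)| * alphaConst n a := by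
  have hG := abs_Gamma_neg_half_pos ha
  rw [heatConst, alphaConst, show -(-a / 2) = a / 2 by ring, four_rpow_half,
    rpow_sub_one two_ne_zero, show (n : ℝ) / 2 - -a / 2 = (n + a) / 2 by ring]
  generalize |Gamma (-a / 2)| = G at hG
  field_simp

theorem heatConst_mul_Gamma_div_Gamma {a : ℝ} (han : a < n) :
    2 * |Gamma (-a / 2)| * heatConst n (((n : ℝ) + a) / 4 - a / 2) *
        (Gamma (((n : ℝ) + a) / 4) / Gamma (((n : ℝ) + a) / 4 - a / 2)) =
      2 * |Gamma (-a / 2)| * heatConst n (((n : ℝ) + a) / 4) *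
        (2 ^ a * (Gamma (((n : ℝ) + a) / 4) / Gamma (((n : ℝ) - a) / 4)) ^ 2) := by
  have h1 := Gamma_pos_of_pos (show 0 < ((n : ℝ) - a) / 4 by linarith)
  have h4 : (4 : ℝ) ^ (-(((n : ℝ) + a) / 4 - a / 2)) = 4 ^ (-(((n : ℝ) + a) / 4)) * 2 ^ a := by
    rw [← four_rpow_half, ← rpow_add (by norm_num)]
    congr 1
    ring
  rw [heatConst, heatConst, h4,
    show (n : ℝ) / 2 - (((n : ℝ) + a) / 4 - a / 2) = (n + a) / 4 by ring,
    show (n : ℝ) / 2 - ((n : ℝ) + a) / 4 = (n - a) / 4 by ring,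
    show ((n : ℝ) + a) / 4 - a / 2 = (n - a) / 4 by ring]
  field_simp

theorem contDiff_norm_sq_mul_norm_rpow {ψ : EuclideanSpace ℝ (Fin n) → ℂ} (hψ : ContDiff ℝ 1 ψ)
    (h0 : (0 : EuclideanSpace ℝ (Fin n)) ∉ tsupport ψ) (q : ℝ) :
    ContDiff ℝ 1 fun x => ‖ψ x‖ ^ 2 * ‖x‖ ^ q := by
  refine contDiff_iff_contDiffAt.2 fun x => ?_
  by_cases hx : x ∈ tsupport ψ
  · have hx0 : x ≠ 0 := fun h => h0 (h ▸ hx)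
    exact (hψ.norm_sq ℝ).contDiffAt.mul
      ((contDiffAt_norm ℝ hx0).rpow_const_of_ne (norm_ne_zero_iff.2 hx0))
  · refine (contDiffAt_const (c := (0 : ℝ))).congr_of_eventuallyEq ?_
    filter_upwards [notMem_tsupport_iff_eventuallyEq.1 hx] with y hy
    simp [hy]

theorem tsupport_norm_sq_mul_subset (ψ : EuclideanSpace ℝ (Fin n) → ℂ)
    (g : EuclideanSpace ℝ (Fin n) → ℝ) : (tsupport fun x => ‖ψ x‖ ^ 2 * g x) ⊆ tsupport ψ := by
  refine closure_mono fun x hx hψ => hx ?_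
  simp [hψ]

end Evaluation

end Auxiliary

/-- Evaluation of the sesquilinear form of `|q|^{b/2}|p|^a|q|^{b/2}` on the
pair `(|ψ|²|x|^γ, |x|^{-γ})`. -/
theorem weighted_sesquilinear_eval
    (n : ℕ) (hn : 0 < n) (a b : ℝ) (ha : a ∈ Set.Ioo (0 : ℝ) 2) (hb : 0 < b)
    (hab : a + b < (n : ℝ)) (γ : ℝ) (hγ : γ = ((n : ℝ) + b - a) / 2)
    (ψ : EuclideanSpace ℝ (Fin n) → ℂ)
    (hsmooth : ContDiff ℝ (⊤ : ℕ∞) ψ) (hsupp : HasCompactSupport ψ)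
    (h0 : (0 : EuclideanSpace ℝ (Fin n)) ∉ tsupport ψ) :
    alphaConst n a *
        ∫ x : EuclideanSpace ℝ (Fin n), ∫ y : EuclideanSpace ℝ (Fin n),
          (‖ψ x‖ ^ 2 * ‖x‖ ^ (b / 2 + γ) - ‖ψ y‖ ^ 2 * ‖y‖ ^ (b / 2 + γ)) *
            (‖x‖ ^ (b / 2 - γ) - ‖y‖ ^ (b / 2 - γ)) / ‖x - y‖ ^ ((n : ℝ) + a) =
      2 ^ a * (Real.Gamma (((n : ℝ) + a) / 4) / Real.Gamma (((n : ℝ) - a) / 4)) ^ 2 *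
        ∫ x : EuclideanSpace ℝ (Fin n), ‖ψ x‖ ^ 2 * ‖x‖ ^ (b - a) := by
  have ha0 := ha.1
  have han : a < n := by linarith
  have hts := tsupport_norm_sq_mul_subset ψ fun x => ‖x‖ ^ (b / 2 + γ)
  have hC := contDiff_norm_sq_mul_norm_rpow (hsmooth.of_le (by exact_mod_cast le_top)) h0
    (b / 2 + γ)
  have hc : HasCompactSupport fun x => ‖ψ x‖ ^ 2 * ‖x‖ ^ (b / 2 + γ) :=
    hsupp.of_isClosed_subset (isClosed_tsupport _) hts
  obtain ⟨K, hK⟩ := hC.lipschitzWith_of_hasCompactSupport hc one_ne_zero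
  have hβ : a / 2 < ((n : ℝ) + a) / 4 := by linarith
  have hβn : ((n : ℝ) + a) / 4 < (n : ℝ) / 2 := by linarith
  have key := integral_form_norm_rpow hn ha hβ hβn hK hc fun h => h0 (hts h)
  have hF := integrable_form_integrand hn (s := n - 2 * (((n : ℝ) + a) / 4)) (by linarith)
    (by linarith) ha hK hc fun h => h0 (hts h)
  rw [neg_sub] at hF
  have e1 : 2 * (((n : ℝ) + a) / 4) - n = b / 2 - γ := by rw [hγ]; ring
  rw [e1] at key hF
  rw [Measure.volume_eq_prod, integral_prod _ hF] at key
  have e2 : ∀ x y : EuclideanSpace ℝ (Fin n),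
      (‖ψ x‖ ^ 2 * ‖x‖ ^ (b / 2 + γ) - ‖ψ y‖ ^ 2 * ‖y‖ ^ (b / 2 + γ)) *
        (‖x‖ ^ (b / 2 - γ) - ‖y‖ ^ (b / 2 - γ)) * ‖x - y‖ ^ (-((n : ℝ) + a)) =
      (‖ψ x‖ ^ 2 * ‖x‖ ^ (b / 2 + γ) - ‖ψ y‖ ^ 2 * ‖y‖ ^ (b / 2 + γ)) *
        (‖x‖ ^ (b / 2 - γ) - ‖y‖ ^ (b / 2 - γ)) / ‖x - y‖ ^ ((n : ℝ) + a) := fun x y => by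
    rw [rpow_neg (norm_nonneg _)]
    exact (div_eq_mul_inv _ _).symm
  have e3 : ∫ x, ‖ψ x‖ ^ 2 * ‖x‖ ^ (b / 2 + γ) * ‖x‖ ^ (2 * (((n : ℝ) + a) / 4 - a / 2) - n) =
      ∫ x, ‖ψ x‖ ^ 2 * ‖x‖ ^ (b - a) := by
    refine integral_congr_ae ?_
    filter_upwards [ae_ne_zero hn] with x hx
    rw [mul_assoc, ← rpow_add (norm_pos_iff.2 hx)]
    congr 2
    rw [hγ]
    ring
  simp only [e2] at key
  rw [e3, heatConst_neg_half n ha] at key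
  have hk := heatConst_mul_Gamma_div_Gamma han
  have hpos := heatConst_pos hβn
  have hG := abs_Gamma_neg_half_pos ha
  refine mul_left_cancel₀ (mul_ne_zero (mul_ne_zero two_ne_zero hG.ne') hpos.ne') ?_
  rw [← mul_assoc (_ * _ * _) (_ * _), ← hk]
  linear_combination key
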